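/- arXiv:2201.10250 — 3 statements merged into one kernel-verified Lean document; each statement's English description precedes it below -/
import Mathlib

section
/- Theorem 1 (upper bound). Assume every cache is assigned at least one user, and let A = max_{λ∈[Λ]} |G_λ|. For integers x ≥ 0 define F1(λ,x) = 0 if x < μ_λ; F1(λ,x) = F_bin(|G_λ|, μ_λ/|G_λ|, x) if μ_λ ≤ x ≤ |G_λ|; and F1(λ,x) = 1 if x > |G_λ|. Then the average delay satisfies T̄(g) ≤ ((Λ−t)/(1+t)) · ( A − Σ_{x=0}^{A−1} max(0, 1 − Λ + Σ_{λ=1}^{Λ} F1(λ,x)) ). -/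
open Finset

noncomputable section

/-- Probability weight of an activity pattern `ω` under independent Bernoulli
activities with success probabilities `p`. -/
def wgt {K : ℕ} (p : Fin K → ℝ) (ω : Fin K → Bool) : ℝ :=
  ∏ k, if ω k then p k else 1 - p k

/-- Load of cache `c` under association `g` and activity pattern `ω`:
the number of active users assigned to cache `c`. -/
def load {K Λ : ℕ} (g : Fin K → Fin Λ) (ω : Fin K → Bool) (c : Fin Λ) : ℕ :=
  ∑ k, if g k = c ∧ ω k = true then 1 else 0

/-- Decreasing rearrangement of a tuple of naturals, indexed by `ℕ`
(value `0` out of range): `sortDescN v 0` is the largest entry,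
`sortDescN v (Λ-1)` the smallest. -/
def sortDescN {Λ : ℕ} (v : Fin Λ → ℕ) (i : ℕ) : ℕ :=
  if h : i < Λ then (v ∘ Tuple.sort v) (Fin.rev ⟨i, h⟩) else 0

/-- Expectation of a real-valued functional of the activity pattern. -/
def expec {K : ℕ} (p : Fin K → ℝ) (f : (Fin K → Bool) → ℝ) : ℝ :=
  ∑ ω : Fin K → Bool, wgt p ω * f ω

/-- Average worst-case delay of association `g`:
`T̄(g) = ∑_{λ=1}^{Λ-t} E[l_λ] C(Λ-λ,t)/C(Λ,t)` (here `i = λ - 1` is 0-based). -/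
def avgDelay {K Λ : ℕ} (p : Fin K → ℝ) (g : Fin K → Fin Λ) (t : ℕ) : ℝ :=
  ∑ i ∈ Finset.range (Λ - t),
    expec p (fun ω => (sortDescN (load g ω) i : ℝ)) * ((Λ - 1 - i).choose t : ℝ) /
      (Λ.choose t : ℝ)

/-- `μ_λ`: expected number of active users assigned to cache `c`. -/
def muC {K Λ : ℕ} (p : Fin K → ℝ) (g : Fin K → Fin Λ) (c : Fin Λ) : ℝ :=
  ∑ k, if g k = c then p k else 0

/-- `σ_λ²`: variance of the number of active users assigned to cache `c`. -/
def sigma2C {K Λ : ℕ} (p : Fin K → ℝ) (g : Fin K → Fin Λ) (c : Fin Λ) : ℝ :=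
  ∑ k, if g k = c then p k * (1 - p k) else 0

/-- `|G_λ|`: the number of users assigned to cache `c`. -/
def Gcard {K Λ : ℕ} (g : Fin K → Fin Λ) (c : Fin Λ) : ℕ :=
  (Finset.univ.filter fun k => g k = c).card

/-- Binomial cumulative distribution function `F_bin(n,q,x)`. -/
def Fbin (n : ℕ) (q : ℝ) (x : ℕ) : ℝ :=
  ∑ i ∈ Finset.range (x + 1), (n.choose i : ℝ) * q ^ i * (1 - q) ^ (n - i)

open Polynomial in
/-- Generating polynomial of a sum of independent Bernoulli variables whose success
probabilities are the elements of `s`. -/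
def bernGen (s : Multiset ℝ) : ℝ[X] :=
  (s.map fun q => C (1 - q) + C q * X).prod

namespace bernGen

open Polynomial

lemma cons (q : ℝ) (s : Multiset ℝ) :
    bernGen (q ::ₘ s) = (C (1 - q) + C q * X) * bernGen s := by
  simp [bernGen]

lemma coeff_zero_factor_mul (q : ℝ) (f : ℝ[X]) :
    ((C (1 - q) + C q * X) * f).coeff 0 = (1 - q) * f.coeff 0 := by
  simp [mul_coeff_zero]

lemma coeff_succ_factor_mul (q : ℝ) (f : ℝ[X]) (k : ℕ) :
    ((C (1 - q) + C q * X) * f).coeff (k + 1) = (1 - q) * f.coeff (k + 1) + q * f.coeff k := by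
  rw [add_mul, coeff_add, mul_assoc, coeff_C_mul, coeff_C_mul, coeff_X_mul]

lemma coeff_succ_one_sub_X_mul (f : ℝ[X]) (k : ℕ) :
    ((1 - X) * f).coeff (k + 1) = f.coeff (k + 1) - f.coeff k := by
  rw [sub_mul, one_mul, coeff_sub, coeff_X_mul]

lemma coeff_nonneg {s : Multiset ℝ} (hs : ∀ q ∈ s, 0 ≤ q ∧ q ≤ 1) (k : ℕ) :
    0 ≤ (bernGen s).coeff k := by
  induction s using Multiset.induction generalizing k with
  | empty =>
    simp only [bernGen, Multiset.map_zero, Multiset.prod_zero, coeff_one]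
    split_ifs <;> norm_num
  | cons q s ih =>
    have hq := hs q (Multiset.mem_cons_self q s)
    have ih := ih fun r hr => hs r (Multiset.mem_cons_of_mem hr)
    rw [cons]
    cases k with
    | zero =>
      rw [coeff_zero_factor_mul]
      exact mul_nonneg (by linarith) (ih 0)
    | succ k =>
      rw [coeff_succ_factor_mul]
      exact add_nonneg (mul_nonneg (by linarith) (ih _)) (mul_nonneg hq.1 (ih _))

/-- The probability mass function of a sum of independent Bernoulli variables is unimodal:
once it increases, it has never decreased before. -/
lemma diff_nonneg_of_diff_pos {s : Multiset ℝ} (hs : ∀ q ∈ s, 0 ≤ q ∧ q ≤ 1) {j k : ℕ}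
    (hjk : j ≤ k) (hk : 0 < ((1 - X) * bernGen s).coeff k) :
    0 ≤ ((1 - X) * bernGen s).coeff j := by
  induction s using Multiset.induction generalizing j k with
  | empty =>
    simp only [bernGen, Multiset.map_zero, Multiset.prod_zero, mul_one, coeff_sub, coeff_one,
      coeff_X] at hk ⊢
    rcases j with _ | j
    · norm_num
    · exfalso
      obtain ⟨k, rfl⟩ : ∃ i, k = i + 1 := ⟨k - 1, by omega⟩
      split_ifs at hk <;> norm_num at *
  | cons q s ih =>
    have hq := hs q (Multiset.mem_cons_self q s)
    have hq' : 0 ≤ 1 - q := by linarith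
    have ih := @ih fun r hr => hs r (Multiset.mem_cons_of_mem hr)
    rw [cons, mul_left_comm] at hk ⊢
    generalize (1 - X) * bernGen s = d at *
    rcases k with _ | k
    · obtain rfl : j = 0 := by omega
      exact hk.le
    rw [coeff_succ_factor_mul] at hk
    by_cases h1 : 0 < d.coeff (k + 1)
    · rcases j with _ | j
      · rw [coeff_zero_factor_mul]
        exact mul_nonneg hq' (ih (by omega) h1)
      · rw [coeff_succ_factor_mul]
        exact add_nonneg (mul_nonneg hq' (ih hjk h1)) (mul_nonneg hq.1 (ih (by omega) h1))
    · have h2 : 0 < d.coeff k := by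
        by_contra h2
        nlinarith [mul_nonneg hq' (sub_nonneg.2 (not_lt.1 h1)),
          mul_nonneg hq.1 (sub_nonneg.2 (not_lt.1 h2))]
      rcases j with _ | j
      · rw [coeff_zero_factor_mul]
        exact mul_nonneg hq' (ih (by omega) h2)
      · rw [coeff_succ_factor_mul]
        rcases Nat.lt_or_ge j k with h | h
        · exact add_nonneg (mul_nonneg hq' (ih h h2)) (mul_nonneg hq.1 (ih (by omega) h2))
        · obtain rfl : j = k := by omega
          exact hk.le

/-- Stein-type identity for a sum of independent Bernoulli variables. -/
lemma sum_mul_diff_erase (s : Multiset ℝ) (k : ℕ) :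
    (s.map fun q => q * (1 - q) * ((1 - X) * bernGen (s.erase q)).coeff k).sum =
      (s.sum - k) * (bernGen s).coeff k := by
  have hder : X * derivative (bernGen s) =
      (s.map fun q => C q * bernGen s - C (q * (1 - q)) * ((1 - X) * bernGen (s.erase q))).sum := by
    unfold bernGen
    rw [derivative_prod, ← Multiset.sum_map_mul_left]
    refine congrArg Multiset.sum (Multiset.map_congr rfl fun q hq => ?_)
    have h := cons q (s.erase q)
    rw [Multiset.cons_erase hq] at h
    simp only [bernGen] at h
    rw [h]
    simp
    ring
  have hX : (X * derivative (bernGen s)).coeff k = k * (bernGen s).coeff k := by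
    cases k with
    | zero => simp
    | succ k =>
      rw [coeff_X_mul, coeff_derivative]
      push_cast
      ring
  have hco := congrArg (lcoeff ℝ k) hder
  rw [map_multiset_sum, Multiset.map_map] at hco
  simp only [Function.comp_def, lcoeff_apply, hX, coeff_sub, coeff_C_mul, Multiset.sum_map_sub,
    Multiset.sum_map_mul_right, Multiset.map_id'] at hco
  linarith

lemma diff_nonpos_of_lt_one {s : Multiset ℝ} {m : ℝ} (hm0 : 0 < m) (hm1 : m < 1)
    (hs : ∀ q ∈ s, 0 ≤ q ∧ q ≤ m) {k : ℕ} (hsum : m + s.sum ≤ k + 1) :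
    ((1 - X) * bernGen s).coeff (k + 1) ≤ 0 := by
  by_contra! hpos
  have hid := sum_mul_diff_erase (m ::ₘ s) (k + 1)
  rw [Multiset.map_cons, Multiset.sum_cons, Multiset.erase_cons_head, Multiset.sum_cons] at hid
  have hco : 0 ≤ (bernGen (m ::ₘ s)).coeff (k + 1) := by
    refine coeff_nonneg (fun q hq => ?_) _
    rcases Multiset.mem_cons.1 hq with rfl | hq
    · exact ⟨hm0.le, hm1.le⟩
    · exact ⟨(hs q hq).1, (hs q hq).2.trans hm1.le⟩
  have hrest : 0 ≤ (s.map fun q =>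
      q * (1 - q) * ((1 - X) * bernGen ((m ::ₘ s).erase q)).coeff (k + 1)).sum := by
    refine Multiset.sum_nonneg fun y hy => ?_
    obtain ⟨q, hq, rfl⟩ := Multiset.mem_map.1 hy
    obtain ⟨hq0, hqm⟩ := hs q hq
    obtain ⟨r, rfl⟩ := Multiset.exists_cons_of_mem hq
    refine mul_nonneg (mul_nonneg hq0 (by linarith)) ?_
    rw [Multiset.cons_swap, Multiset.erase_cons_head, cons, mul_left_comm, coeff_succ_factor_mul]
    rw [cons, mul_left_comm, coeff_succ_factor_mul] at hpos
    have hr : ∀ y ∈ r, 0 ≤ y ∧ y ≤ 1 := fun y hy =>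
      ⟨(hs y (Multiset.mem_cons_of_mem hy)).1,
        (hs y (Multiset.mem_cons_of_mem hy)).2.trans hm1.le⟩
    by_cases hv : 0 < ((1 - X) * bernGen r).coeff (k + 1)
    · exact add_nonneg (mul_nonneg (by linarith) hv.le)
        (mul_nonneg hm0.le (diff_nonneg_of_diff_pos hr (Nat.le_succ k) hv))
    · push Not at hv
      have hu : 0 ≤ ((1 - X) * bernGen r).coeff k := by
        by_contra! hu
        nlinarith
      nlinarith
  have : 0 < m * (1 - m) * ((1 - X) * bernGen s).coeff (k + 1) :=
    mul_pos (mul_pos hm0 (by linarith)) hpos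
  push_cast at hid
  nlinarith

lemma exists_bound_lt_one {s : Multiset ℝ} (hs : ∀ q ∈ s, q < 1) :
    ∃ m : ℝ, 0 < m ∧ m < 1 ∧ ∀ q ∈ s, q ≤ m := by
  induction s using Multiset.induction with
  | empty => exact ⟨1 / 2, by norm_num, by norm_num, by simp⟩
  | cons q s ih =>
    obtain ⟨m, h0, h1, h⟩ := ih fun r hr => hs r (Multiset.mem_cons_of_mem hr)
    refine ⟨max q m, lt_max_of_lt_right h0, max_lt (hs q (Multiset.mem_cons_self q s)) h1, ?_⟩
    intro r hr
    rcases Multiset.mem_cons.1 hr with rfl | hr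
    · exact le_max_left _ _
    · exact (h r hr).trans (le_max_right _ _)

lemma diff_nonpos_of_sum_le {s : Multiset ℝ} (hs : ∀ q ∈ s, 0 ≤ q ∧ q ≤ 1) {k : ℕ}
    (hsum : s.sum ≤ k) : ((1 - X) * bernGen s).coeff (k + 1) ≤ 0 := by
  induction hn : s.card generalizing s k with
  | zero =>
    obtain rfl := Multiset.card_eq_zero.1 hn
    simp only [bernGen, Multiset.map_zero, Multiset.prod_zero, mul_one, coeff_sub, coeff_one,
      coeff_X]
    split_ifs <;> norm_num at *
  | succ n ih =>
    by_cases h1 : (1 : ℝ) ∈ s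
    · obtain ⟨r, rfl⟩ := Multiset.exists_cons_of_mem h1
      have hr : ∀ q ∈ r, 0 ≤ q ∧ q ≤ 1 := fun q hq => hs q (Multiset.mem_cons_of_mem hq)
      have hr0 : 0 ≤ r.sum := Multiset.sum_nonneg fun q hq => (hr q hq).1
      rw [Multiset.sum_cons] at hsum
      rcases k with _ | k
      · norm_num at hsum
        linarith
      rw [cons, mul_left_comm, coeff_succ_factor_mul]
      have := ih hr (k := k) (by push_cast at hsum; linarith) (by simpa using hn)
      linarith
    · obtain ⟨m, h0, hm1, hm⟩ := exists_bound_lt_one (s := s) fun q hq =>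
        lt_of_le_of_ne (hs q hq).2 fun h => h1 (h ▸ hq)
      exact diff_nonpos_of_lt_one h0 hm1 (fun q hq => ⟨(hs q hq).1, hm q hq⟩) (by linarith)

/-- The probability mass function does not increase from `k` to `k + 1` if the mean augmented
by an upper bound of the success probabilities is at most `k + 1`. -/
lemma diff_nonpos {s : Multiset ℝ} {m : ℝ} (hm0 : 0 < m) (hm1 : m ≤ 1)
    (hs : ∀ q ∈ s, 0 ≤ q ∧ q ≤ m) {k : ℕ} (hsum : m + s.sum ≤ k + 1) :
    ((1 - X) * bernGen s).coeff (k + 1) ≤ 0 := by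
  rcases hm1.lt_or_eq with h | rfl
  · exact diff_nonpos_of_lt_one hm0 h hs hsum
  · exact diff_nonpos_of_sum_le hs (by linarith)

/-- Cumulative distribution function attached to `bernGen s`. -/
def cdf (s : Multiset ℝ) (x : ℕ) : ℝ :=
  ∑ i ∈ Finset.range (x + 1), (bernGen s).coeff i

lemma sum_coeff_one_sub_X_mul (f : ℝ[X]) (x : ℕ) :
    ∑ i ∈ Finset.range (x + 1), ((1 - X) * f).coeff i = f.coeff x := by
  induction x with
  | zero => simp [mul_coeff_zero]
  | succ x ih => rw [Finset.sum_range_succ, ih, coeff_succ_one_sub_X_mul]; ring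

lemma cdf_sub_cdf {a b l m : ℝ} (h : a + b = m + l) (s : Multiset ℝ) (x : ℕ) :
    cdf (m ::ₘ l ::ₘ s) x - cdf (a ::ₘ b ::ₘ s) x =
      (m * l - a * b) * ((1 - X) * bernGen s).coeff x := by
  have hpoly : bernGen (m ::ₘ l ::ₘ s) - bernGen (a ::ₘ b ::ₘ s) =
      (1 - X) * (C (m * l - a * b) * ((1 - X) * bernGen s)) := by
    obtain rfl : b = m + l - a := by linarith
    simp only [cons, C_sub, C_add, C_mul, C_1]
    ring
  rw [cdf, cdf, ← Finset.sum_sub_distrib]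
  simp only [← coeff_sub, hpoly]
  rw [sum_coeff_one_sub_X_mul, coeff_C_mul]

lemma exists_mem_forall_le {s : Multiset ℝ} (hs : s ≠ 0) : ∃ m ∈ s, ∀ q ∈ s, q ≤ m := by
  obtain ⟨m, hm, h⟩ := s.toFinset.exists_max_image id (by simpa [Finset.nonempty_iff_ne_empty])
  exact ⟨m, by simpa using hm, fun q hq => h q (by simpa using hq)⟩

lemma sum_lt_card_mul {s : Multiset ℝ} {a l : ℝ} (hs : ∀ q ∈ s, q ≤ a) (hl : l ∈ s)
    (hla : l < a) : s.sum < s.card * a := by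
  obtain ⟨r, rfl⟩ := Multiset.exists_cons_of_mem hl
  have h := Multiset.sum_le_card_nsmul r a fun q hq => hs q (Multiset.mem_cons_of_mem hq)
  rw [nsmul_eq_mul] at h
  rw [Multiset.sum_cons, Multiset.card_cons]
  push_cast
  linarith

/-- Hoeffding's comparison: above the mean, the cumulative distribution function of a sum of
independent Bernoulli variables dominates that of the binomial law with the same mean. -/
theorem cdf_replicate_le {s : Multiset ℝ} {a : ℝ} (hs : ∀ q ∈ s, 0 ≤ q ∧ q ≤ 1)
    (hsum : s.sum = s.card * a) {x : ℕ} (hx : s.sum ≤ x) :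
    cdf (Multiset.replicate s.card a) x ≤ cdf s x := by
  induction hn : (s.filter (· ≠ a)).card using Nat.strong_induction_on generalizing s with
  | _ n ih =>
  by_cases hall : ∀ q ∈ s, q = a
  · rw [← Multiset.eq_replicate_card.2 hall]
  push Not at hall
  obtain ⟨q, hq, hqa⟩ := hall
  obtain ⟨m, hm, hmax⟩ := exists_mem_forall_le (s := s) (by rintro rfl; simp at hq)
  have ham : a < m := by
    by_contra! h
    exact (sum_lt_card_mul (fun r hr => (hmax r hr).trans h) hq
      (lt_of_le_of_ne ((hmax q hq).trans h) hqa)).ne hsum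
  obtain ⟨u, rfl⟩ := Multiset.exists_cons_of_mem hm
  obtain ⟨l, hl, hla⟩ : ∃ l ∈ u, l < a := by
    by_contra! h
    have h1 := Multiset.card_nsmul_le_sum (s := u) (a := a) h
    rw [nsmul_eq_mul] at h1
    rw [Multiset.sum_cons, Multiset.card_cons] at hsum
    push_cast at hsum
    linarith
  obtain ⟨r, rfl⟩ := Multiset.exists_cons_of_mem hl
  simp only [Multiset.mem_cons, forall_eq_or_imp] at hs hmax
  obtain ⟨hm01, hl01, hr⟩ := hs
  simp only [Multiset.sum_cons, Multiset.card_cons] at hsum hx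
  have hr0 : 0 ≤ r.sum := Multiset.sum_nonneg fun q hq => (hr q hq).1
  obtain ⟨k, rfl⟩ : ∃ k, x = k + 1 := by
    refine ⟨x - 1, ?_⟩
    rcases x with _ | x
    · norm_num at hx
      linarith
    · omega
  have hd : ((1 - X) * bernGen r).coeff (k + 1) ≤ 0 :=
    diff_nonpos (m := m) (by linarith) hm01.2
      (fun q hq => ⟨(hr q hq).1, hmax.2.2 q hq⟩) (by push_cast at hx; linarith)
  have hcmp := cdf_sub_cdf (a := a) (b := m + l - a) (l := l) (m := m) (by ring) r (k + 1)
  have hsum' : (a ::ₘ (m + l - a) ::ₘ r).sum = m + (l + r.sum) := by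
    simp only [Multiset.sum_cons]; ring
  have hstep := ih ((a ::ₘ (m + l - a) ::ₘ r).filter (· ≠ a)).card
    (by
      rw [← hn]
      simp only [Multiset.filter_cons, ne_eq, not_true_eq_false, ham.ne', hla.ne,
        not_false_eq_true, if_true, if_false]
      split_ifs <;> simp)
    (s := a ::ₘ (m + l - a) ::ₘ r)
    (by
      simp only [Multiset.mem_cons, forall_eq_or_imp]
      exact ⟨⟨by linarith, by linarith⟩, ⟨by linarith, by linarith⟩, hr⟩)
    (by rw [hsum']; simpa using hsum) (by rw [hsum']; exact hx) rfl
  simp only [Multiset.card_cons] at hstep ⊢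
  nlinarith [mul_nonneg (sub_nonneg.2 ham.le) (sub_nonneg.2 hla.le)]

lemma cdf_replicate (n : ℕ) (q : ℝ) (x : ℕ) :
    cdf (Multiset.replicate n q) x = Fbin n q x := by
  refine Finset.sum_congr rfl fun i _ => ?_
  rw [bernGen, Multiset.map_replicate, Multiset.prod_replicate, add_comm, add_pow, finsetSum_coeff]
  have h : ∀ j, ((C q * X) ^ j * C (1 - q) ^ (n - j) * (n.choose j : ℝ[X])).coeff i =
      if i = j then (n.choose i : ℝ) * q ^ i * (1 - q) ^ (n - i) else 0 := by
    intro j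
    have : ((C q * X) ^ j * C (1 - q) ^ (n - j) * (n.choose j : ℝ[X])) =
        C ((n.choose j : ℝ) * q ^ j * (1 - q) ^ (n - j)) * X ^ j := by
      simp only [C_mul, C_pow, mul_pow, map_natCast]
      ring
    rw [this, coeff_C_mul, coeff_X_pow]
    split_ifs with h
    · rw [h, mul_one]
    · rw [mul_zero]
  simp only [h, Finset.sum_ite_eq, Finset.mem_range]
  split_ifs with hi
  · rfl
  · rw [Nat.choose_eq_zero_of_lt (by omega)]
    simp

end bernGen

section Delay

variable {K Λ : ℕ} {p : Fin K → ℝ} {g : Fin K → Fin Λ}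

lemma wgt_nonneg (hp : ∀ k, 0 ≤ p k ∧ p k ≤ 1) (ω : Fin K → Bool) : 0 ≤ wgt p ω := by
  refine Finset.prod_nonneg fun k _ => ?_
  split_ifs
  · exact (hp k).1
  · linarith [(hp k).2]

lemma sum_wgt (p : Fin K → ℝ) : ∑ ω, wgt p ω = 1 := by
  have h := (Finset.prod_univ_sum (fun _ : Fin K => (Finset.univ : Finset Bool))
    fun k b => if b then p k else 1 - p k).symm
  rw [Fintype.piFinset_univ] at h
  simpa [wgt] using h

lemma expec_mono (hp : ∀ k, 0 ≤ p k ∧ p k ≤ 1) {f h : (Fin K → Bool) → ℝ} (hfh : ∀ ω, f ω ≤ h ω) :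
    expec p f ≤ expec p h :=
  Finset.sum_le_sum fun ω _ => mul_le_mul_of_nonneg_left (hfh ω) (wgt_nonneg hp ω)

lemma expec_const (p : Fin K → ℝ) (a : ℝ) : expec p (fun _ => a) = a := by
  rw [expec, ← Finset.sum_mul, sum_wgt, one_mul]

lemma expec_add (p : Fin K → ℝ) (f h : (Fin K → Bool) → ℝ) :
    expec p (fun ω => f ω + h ω) = expec p f + expec p h := by
  simp only [expec, mul_add, Finset.sum_add_distrib]

lemma expec_sub (p : Fin K → ℝ) (f h : (Fin K → Bool) → ℝ) :
    expec p (fun ω => f ω - h ω) = expec p f - expec p h := by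
  simp only [expec, mul_sub, Finset.sum_sub_distrib]

lemma expec_sum {ι : Type*} (p : Fin K → ℝ) (s : Finset ι) (f : ι → (Fin K → Bool) → ℝ) :
    expec p (fun ω => ∑ i ∈ s, f i ω) = ∑ i ∈ s, expec p (f i) := by
  simp only [expec, Finset.mul_sum]
  exact Finset.sum_comm

open Polynomial in
lemma sum_wgt_mul_X_pow_load (p : Fin K → ℝ) (g : Fin K → Fin Λ) (c : Fin Λ) :
    ∑ ω, C (wgt p ω) * X ^ load g ω c =
      bernGen ((Finset.univ.filter fun k => g k = c).val.map p) := by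
  have h := Finset.prod_univ_sum (fun _ : Fin K => (Finset.univ : Finset Bool))
    fun k b => C (if b then p k else 1 - p k) * X ^ (if g k = c ∧ b = true then 1 else 0)
  rw [Fintype.piFinset_univ] at h
  have hl : ∀ ω : Fin K → Bool, C (wgt p ω) * X ^ load g ω c =
      ∏ k, C (if ω k then p k else 1 - p k) * X ^ (if g k = c ∧ ω k = true then 1 else 0) := by
    intro ω
    rw [Finset.prod_mul_distrib, Finset.prod_pow_eq_pow_sum, wgt, map_prod, load]
  rw [Finset.sum_congr rfl fun ω _ => hl ω, ← h, bernGen, Multiset.map_map]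
  change _ = ∏ k ∈ Finset.univ.filter (fun k => g k = c), (C (1 - p k) + C (p k) * X)
  rw [Finset.prod_filter]
  refine Finset.prod_congr rfl fun k _ => ?_
  by_cases hk : g k = c
  · simp [hk, add_comm]
  · simp [hk]

lemma expec_load_le (p : Fin K → ℝ) (g : Fin K → Fin Λ) (c : Fin Λ) (x : ℕ) :
    expec p (fun ω => if load g ω c ≤ x then 1 else 0) =
      bernGen.cdf ((Finset.univ.filter fun k => g k = c).val.map p) x := by
  rw [bernGen.cdf, ← sum_wgt_mul_X_pow_load, expec]
  simp only [Polynomial.finsetSum_coeff, Polynomial.coeff_C_mul, Polynomial.coeff_X_pow]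
  rw [Finset.sum_comm]
  refine Finset.sum_congr rfl fun ω _ => ?_
  rw [← Finset.mul_sum, Finset.sum_ite_eq']
  simp

lemma load_le_Gcard (g : Fin K → Fin Λ) (ω : Fin K → Bool) (c : Fin Λ) :
    load g ω c ≤ Gcard g c := by
  rw [load, ← Finset.card_filter]
  exact Finset.card_le_card fun k => by simp +contextual

/-- Distribution-function bound for the load of a single cache. -/
lemma le_expec_load_le (hp : ∀ k, 0 ≤ p k ∧ p k ≤ 1) (hg : ∀ c, 1 ≤ Gcard g c)
    (c : Fin Λ) (x : ℕ) :
    (if (x : ℝ) < muC p g c then 0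
      else if x ≤ Gcard g c then Fbin (Gcard g c) (muC p g c / (Gcard g c : ℝ)) x
      else 1) ≤ expec p (fun ω => if load g ω c ≤ x then 1 else 0) := by
  split_ifs with h1 h2
  · exact (expec_const p 0).ge.trans (expec_mono hp fun ω => by split_ifs <;> norm_num)
  · have hcard : ((Finset.univ.filter fun k => g k = c).val.map p).card = Gcard g c := by
      rw [Multiset.card_map]
      rfl
    have hsum : ((Finset.univ.filter fun k => g k = c).val.map p).sum = muC p g c := by
      rw [muC, ← Finset.sum_filter]
      rfl
    have hpos : (Gcard g c : ℝ) ≠ 0 := by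
      have := hg c
      positivity
    rw [expec_load_le, ← bernGen.cdf_replicate, ← hcard]
    refine bernGen.cdf_replicate_le ?_ ?_ ?_
    · intro q hq
      obtain ⟨k, _, rfl⟩ := Multiset.mem_map.1 hq
      exact hp k
    · rw [hcard, hsum, mul_div_cancel₀ _ hpos]
    · rw [hsum]
      exact not_lt.1 h1
  · refine (expec_const p 1).ge.trans (expec_mono hp fun ω => ?_)
    rw [if_pos ((load_le_Gcard g ω c).trans (not_le.1 h2).le)]

lemma one_sub_add_sum_le_sup_indicator (v : Fin Λ → ℕ) (x : ℕ) :
    1 - (Λ : ℝ) + ∑ c, (if v c ≤ x then (1 : ℝ) else 0) ≤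
      if Finset.univ.sup v ≤ x then 1 else 0 := by
  have hcard : ∑ _c : Fin Λ, (1 : ℝ) = Λ := by simp
  rw [← hcard, sub_add, ← Finset.sum_sub_distrib]
  have hnn : ∀ c ∈ Finset.univ, 0 ≤ (1 : ℝ) - (if v c ≤ x then (1 : ℝ) else 0) := by
    intro c _
    split_ifs <;> norm_num
  split_ifs with h
  · linarith [Finset.sum_nonneg hnn]
  · obtain ⟨c, hc⟩ : ∃ c, x < v c := by
      by_contra! h'
      exact h (Finset.sup_le fun c _ => h' c)
    have := Finset.single_le_sum hnn (Finset.mem_univ c)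
    rw [if_neg (not_le.2 hc)] at this
    linarith

lemma cast_eq_sub_sum_indicator {n a : ℕ} (h : n ≤ a) :
    (n : ℝ) = a - ∑ x ∈ Finset.range a, (if n ≤ x then (1 : ℝ) else 0) := by
  have hf : (Finset.range a).filter (fun x => n ≤ x) = Finset.Ico n a := by
    ext x
    simp [and_comm]
  rw [Finset.sum_boole, hf, Nat.card_Ico, Nat.cast_sub h]
  ring

lemma expec_sup_load_le (hp : ∀ k, 0 ≤ p k ∧ p k ≤ 1) (hg : ∀ c, 1 ≤ Gcard g c) :
    expec p (fun ω => ((Finset.univ.sup (load g ω) : ℕ) : ℝ)) ≤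
      ((Finset.univ.sup (fun c => Gcard g c) : ℕ) : ℝ) -
        ∑ x ∈ Finset.range (Finset.univ.sup (fun c => Gcard g c)),
          max 0 (1 - (Λ : ℝ) +
            ∑ c : Fin Λ,
              (if (x : ℝ) < muC p g c then 0
               else if x ≤ Gcard g c then Fbin (Gcard g c) (muC p g c / (Gcard g c : ℝ)) x
               else 1)) := by
  have hM : ∀ ω, Finset.univ.sup (load g ω) ≤ Finset.univ.sup (fun c => Gcard g c) := fun ω =>
    Finset.sup_mono_fun fun c _ => load_le_Gcard g ω c
  simp only [cast_eq_sub_sum_indicator (hM _)]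
  rw [expec_sub, expec_const, expec_sum]
  refine sub_le_sub_left (Finset.sum_le_sum fun x _ => max_le ?_ ?_) _
  · exact (expec_const p 0).ge.trans (expec_mono hp fun ω => by split_ifs <;> norm_num)
  · refine le_trans ?_ (expec_mono hp fun ω => one_sub_add_sum_le_sup_indicator (load g ω) x)
    rw [expec_add, expec_const, expec_sum]
    gcongr with c
    exact le_expec_load_le hp hg c x

lemma sortDescN_le_sup (v : Fin Λ → ℕ) (i : ℕ) : sortDescN v i ≤ Finset.univ.sup v := by
  unfold sortDescN
  split_ifs
  · exact Finset.le_sup (f := v) (Finset.mem_univ _)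
  · exact Nat.zero_le _

lemma sum_choose_div {Λ t : ℕ} (ht : t < Λ) :
    ∑ i ∈ Finset.range (Λ - t), ((Λ - 1 - i).choose t : ℝ) / (Λ.choose t : ℝ) =
      ((Λ : ℝ) - t) / (1 + t) := by
  have hpos : (Λ.choose t : ℝ) ≠ 0 := by
    exact_mod_cast (Nat.choose_pos ht.le).ne'
  have hsum : ∀ n, ∑ i ∈ Finset.range n, (t + n - 1 - i).choose t = (t + n).choose (t + 1) := by
    intro n
    induction n with
    | zero => simp
    | succ n ih =>
      rw [Finset.sum_range_succ', ← add_assoc, Nat.choose_succ_succ, ← ih, add_comm]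
      congr 1
      exact Finset.sum_congr rfl fun i _ => by congr 1; omega
  have h := hsum (Λ - t)
  rw [Nat.add_sub_cancel' ht.le] at h
  have h' := Nat.choose_succ_right_eq Λ t
  rw [← Finset.sum_div, ← Nat.cast_sum, h, div_eq_div_iff hpos (by positivity)]
  have h'' : ((Λ.choose (t + 1) * (t + 1) : ℕ) : ℝ) = (Λ.choose t * (Λ - t) : ℕ) := by rw [h']
  push_cast [Nat.cast_sub ht.le] at h''
  linarith

end Delay

/-- Theorem 1 (upper bound). -/
theorem theorem1_upper_bound {K Λ t : ℕ} (hΛ : 2 ≤ Λ) (ht1 : 1 ≤ t) (ht2 : t ≤ Λ - 1)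
    (p : Fin K → ℝ) (hp : ∀ k, 0 ≤ p k ∧ p k ≤ 1)
    (g : Fin K → Fin Λ) (hg : ∀ c, 1 ≤ Gcard g c) :
    avgDelay p g t ≤
      ((Λ : ℝ) - t) / (1 + t) *
        (((Finset.univ.sup (fun c => Gcard g c) : ℕ) : ℝ) -
          ∑ x ∈ Finset.range (Finset.univ.sup (fun c => Gcard g c)),
            max 0 (1 - (Λ : ℝ) +
              ∑ c : Fin Λ,
                (if (x : ℝ) < muC p g c then 0
                 else if x ≤ Gcard g c then Fbin (Gcard g c) (muC p g c / (Gcard g c : ℝ)) x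
                 else 1))) := by
  set B := ((Finset.univ.sup (fun c => Gcard g c) : ℕ) : ℝ) - _
  rw [← sum_choose_div (show t < Λ by omega), Finset.sum_mul, avgDelay]
  refine Finset.sum_le_sum fun i _ => ?_
  have h : expec p (fun ω => (sortDescN (load g ω) i : ℝ)) ≤ B :=
    (expec_mono hp fun ω => Nat.cast_le.2 (sortDescN_le_sup _ i)).trans (expec_sup_load_le hp hg)
  rw [mul_div_assoc, mul_comm]
  gcongr
end
end

section
/- Lemma 4 (first regime). For each n let M_n be the maximum of Λ_n i.i.d. Binomial(I_n, p_n) random variables, with Λ_n → ∞, integers I_n ≥ 1 and p_n ∈ (0, 1/2], and suppose I_n p_n / (log Λ_n)³ → ∞. Fix α > 0 and set k_{α,n} = I_n p_n + sqrt( 2 α I_n p_n (1−p_n) log Λ_n ). Then: if α > 1, ℙ( M_n ≥ k_{α,n} ) → 0 as n → ∞; and if 0 < α < 1, ℙ( M_n ≥ k_{α,n} ) → 1 as n → ∞. -/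
open Finset

noncomputable section

/-- Probability weight of an outcome `ω` of `Λ` independent `Binomial(I,p)` random
variables (each coordinate takes value `i ∈ {0,…,I}` with probability
`C(I,i) p^i (1-p)^(I-i)`). -/
def binWgt (I Λ : ℕ) (p : ℝ) (ω : Fin Λ → Fin (I + 1)) : ℝ :=
  ∏ c, (I.choose (ω c) : ℝ) * p ^ ((ω c) : ℕ) * (1 - p) ^ (I - ((ω c) : ℕ))

/-- `ℙ(M ≥ k)` where `M` is the maximum of `Λ` i.i.d. `Binomial(I,p)` variables and
`k : ℝ` is a threshold. -/
def probMaxGe (I Λ : ℕ) (p : ℝ) (k : ℝ) : ℝ :=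
  ∑ ω : Fin Λ → Fin (I + 1),
    binWgt I Λ p ω *
      (if k ≤ ((Finset.univ.sup (fun c => ((ω c) : ℕ)) : ℕ) : ℝ) then 1 else 0)

/-- The probability that a `Binomial(I,p)` variable equals `j`. -/
def binPmf (I : ℕ) (p : ℝ) (j : Fin (I + 1)) : ℝ :=
  (I.choose j : ℝ) * p ^ (j : ℕ) * (1 - p) ^ (I - (j : ℕ))

/-- The probability that a `Binomial(I,p)` variable is at least `k`. -/
def binTail (I : ℕ) (p k : ℝ) : ℝ :=
  ∑ j : Fin (I + 1), binPmf I p j * (if k ≤ ((j : ℕ) : ℝ) then 1 else 0)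

/-- The moment generating function of a centred `Binomial(I,p)` variable. -/
def binMgf (I : ℕ) (p s : ℝ) : ℝ :=
  ∑ j : Fin (I + 1), binPmf I p j * Real.exp (s * (((j : ℕ) : ℝ) - I * p))

lemma binPmf_nonneg (I : ℕ) {p : ℝ} (h0 : 0 ≤ p) (h1 : p ≤ 1) (j : Fin (I + 1)) :
    0 ≤ binPmf I p j := by
  have : 0 ≤ 1 - p := by linarith
  unfold binPmf; positivity

lemma sum_binPmf (I : ℕ) (p : ℝ) : ∑ j, binPmf I p j = 1 := by
  have h := add_pow p (1 - p) I
  rw [← Fin.sum_univ_eq_sum_range (fun m => p ^ m * (1 - p) ^ (I - m) * (I.choose m : ℝ))] at h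
  rw [add_sub_cancel, one_pow] at h
  rw [h]
  exact Finset.sum_congr rfl fun j _ => by unfold binPmf; ring

lemma binTail_nonneg (I : ℕ) {p : ℝ} (h0 : 0 ≤ p) (h1 : p ≤ 1) (k : ℝ) :
    0 ≤ binTail I p k :=
  Finset.sum_nonneg fun j _ => mul_nonneg (binPmf_nonneg I h0 h1 j) (by split_ifs <;> norm_num)

lemma binTail_le_one (I : ℕ) {p : ℝ} (h0 : 0 ≤ p) (h1 : p ≤ 1) (k : ℝ) :
    binTail I p k ≤ 1 := by
  rw [← sum_binPmf I p]
  refine Finset.sum_le_sum fun j _ => mul_le_of_le_one_right (binPmf_nonneg I h0 h1 j) ?_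
  split_ifs <;> norm_num

lemma binMgf_eq_pow (I : ℕ) (p s : ℝ) :
    binMgf I p s = (p * Real.exp (s * (1 - p)) + (1 - p) * Real.exp (-(s * p))) ^ I := by
  rw [add_pow, ← Fin.sum_univ_eq_sum_range (fun m => (p * Real.exp (s * (1 - p))) ^ m *
    ((1 - p) * Real.exp (-(s * p))) ^ (I - m) * (I.choose m : ℝ))]
  refine Finset.sum_congr rfl fun j _ => ?_
  have hj : (j : ℕ) ≤ I := Nat.lt_succ_iff.mp j.2
  have key : Real.exp (s * (((j : ℕ) : ℝ) - I * p)) =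
      Real.exp (s * (1 - p)) ^ (j : ℕ) * Real.exp (-(s * p)) ^ (I - (j : ℕ)) := by
    rw [← Real.exp_nat_mul, ← Real.exp_nat_mul, ← Real.exp_add, Nat.cast_sub hj]
    ring_nf
  rw [key, mul_pow, mul_pow, binPmf]
  ring

lemma probMaxGe_eq (I Λ : ℕ) (p : ℝ) {k : ℝ} (hk : 0 < k) :
    probMaxGe I Λ p k = 1 - (1 - binTail I p k) ^ Λ := by
  have hw : ∀ ω : Fin Λ → Fin (I + 1), binWgt I Λ p ω = ∏ c, binPmf I p (ω c) := fun _ => rfl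
  have hind : ∀ ω : Fin Λ → Fin (I + 1),
      (if k ≤ ((Finset.univ.sup (fun c => ((ω c) : ℕ)) : ℕ) : ℝ) then (1 : ℝ) else 0) =
        1 - ∏ c, (1 - if k ≤ ((ω c : ℕ) : ℝ) then (1 : ℝ) else 0) := by
    intro ω
    split_ifs with h
    · obtain ⟨c, hc⟩ : ∃ c, k ≤ ((ω c : ℕ) : ℝ) := by
        by_contra! hcon
        have hlt : Finset.univ.sup (fun c => ((ω c) : ℕ)) < ⌈k⌉₊ := by
          rw [Finset.sup_lt_iff (by simpa using hk)]
          exact fun c _ => Nat.lt_ceil.mpr (hcon c)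
        exact absurd h (not_le.mpr (Nat.lt_ceil.mp hlt))
      rw [Finset.prod_eq_zero (Finset.mem_univ c) (by simp [hc]), sub_zero]
    · rw [Finset.prod_eq_one, sub_self]
      intro c _
      rw [if_neg, sub_zero]
      intro hc
      refine h (hc.trans ?_)
      exact_mod_cast Finset.le_sup (f := fun c => ((ω c) : ℕ)) (Finset.mem_univ c)
  have h1 : (1 : ℝ) - binTail I p k =
      ∑ j, binPmf I p j * (1 - if k ≤ ((j : ℕ) : ℝ) then (1 : ℝ) else 0) := by
    simp only [mul_sub, mul_one, Finset.sum_sub_distrib, sum_binPmf, binTail]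
  have h2 : ∑ ω : Fin Λ → Fin (I + 1), ∏ c, binPmf I p (ω c) = 1 := by
    rw [← Fintype.sum_pow, sum_binPmf, one_pow]
  unfold probMaxGe
  simp only [hw, hind, mul_sub, mul_one, Finset.sum_sub_distrib, h2]
  rw [h1, Fintype.sum_pow]
  simp only [← Finset.prod_mul_distrib]

lemma abs_exp_sub_quadratic_le {x : ℝ} (hx : |x| ≤ 1) :
    |Real.exp x - (1 + x + x ^ 2 / 2)| ≤ |x| ^ 3 := by
  have h := Real.exp_bound hx (n := 3) (by norm_num)
  simp only [Finset.sum_range_succ, Finset.sum_range_zero, Nat.factorial] at h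
  norm_num at h
  refine h.trans ?_
  have : 0 ≤ |x| ^ 3 := by positivity
  linarith

/-- Third order expansion of the moment generating function of a centred Bernoulli variable. -/
lemma abs_bernoulli_mgf_sub_le {p s : ℝ} (h0 : 0 ≤ p) (h1 : p ≤ 1) (hs : 0 ≤ s) (hs1 : s ≤ 1) :
    |p * Real.exp (s * (1 - p)) + (1 - p) * Real.exp (-(s * p)) -
      (1 + p * (1 - p) * s ^ 2 / 2)| ≤ p * (1 - p) * s ^ 3 := by
  have hq : 0 ≤ 1 - p := by linarith
  have ha : |s * (1 - p)| = s * (1 - p) := abs_of_nonneg (by positivity)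
  have hb : |-(s * p)| = s * p := by rw [abs_neg, abs_of_nonneg (by positivity)]
  have e1 := abs_exp_sub_quadratic_le (x := s * (1 - p)) (by rw [ha]; nlinarith)
  have e2 := abs_exp_sub_quadratic_le (x := -(s * p)) (by rw [hb]; nlinarith)
  rw [ha] at e1
  rw [hb] at e2
  rw [abs_le] at e1 e2 ⊢
  have hs3 : 0 ≤ p * (1 - p) * s ^ 3 := by positivity
  have hmix : p * (s * (1 - p)) ^ 3 + (1 - p) * (s * p) ^ 3 ≤ p * (1 - p) * s ^ 3 := by
    have : p * (s * (1 - p)) ^ 3 + (1 - p) * (s * p) ^ 3 =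
      p * (1 - p) * s ^ 3 * (1 - 2 * (p * (1 - p))) := by ring
    rw [this]
    exact mul_le_of_le_one_right hs3 (by nlinarith)
  constructor
  · nlinarith [mul_le_mul_of_nonneg_left e1.1 h0, mul_le_mul_of_nonneg_left e2.1 hq]
  · nlinarith [mul_le_mul_of_nonneg_left e1.2 h0, mul_le_mul_of_nonneg_left e2.2 hq]

lemma binMgf_le (I : ℕ) {p s : ℝ} (h0 : 0 ≤ p) (h1 : p ≤ 1) (hs : 0 ≤ s) (hs1 : s ≤ 1) :
    binMgf I p s ≤ Real.exp (I * p * (1 - p) * s ^ 2 / 2 * (1 + 3 * s)) := by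
  have hq : 0 ≤ 1 - p := by linarith
  have h := (abs_le.mp (abs_bernoulli_mgf_sub_le h0 h1 hs hs1)).2
  have hs3 : 0 ≤ p * (1 - p) * s ^ 3 := by positivity
  have e : (I : ℝ) * p * (1 - p) * s ^ 2 / 2 * (1 + 3 * s) =
      I * (p * (1 - p) * s ^ 2 / 2 * (1 + 3 * s)) := by ring
  rw [binMgf_eq_pow, e, Real.exp_nat_mul]
  refine pow_le_pow_left₀ (by positivity) ?_ I
  refine le_trans ?_ (Real.add_one_le_exp _)
  nlinarith

lemma exp_sub_sq_le_one_add {y : ℝ} (hy : 0 ≤ y) : Real.exp (y - y ^ 2) ≤ 1 + y := by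
  have h1 : y - y ^ 2 ≤ y / (1 + y) := by
    rw [le_div_iff₀ (by linarith)]
    nlinarith [pow_nonneg hy 3]
  have h2 : (1 + y)⁻¹ ≤ Real.exp (-(y / (1 + y))) := by
    refine le_trans (le_of_eq ?_) (Real.add_one_le_exp _)
    field_simp
    ring
  rw [Real.exp_neg] at h2
  exact (Real.exp_le_exp.mpr h1).trans
    ((inv_le_inv₀ (by linarith) (Real.exp_pos _)).mp h2)

lemma le_binMgf (I : ℕ) {p s : ℝ} (h0 : 0 ≤ p) (h1 : p ≤ 1) (hs : 0 ≤ s) (hs1 : s ≤ 1 / 2) :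
    Real.exp (I * p * (1 - p) * s ^ 2 / 2 * (1 - 3 * s)) ≤ binMgf I p s := by
  have hq : 0 ≤ 1 - p := by linarith
  have h := (abs_le.mp (abs_bernoulli_mgf_sub_le h0 h1 hs (by linarith))).1
  have e : (I : ℝ) * p * (1 - p) * s ^ 2 / 2 * (1 - 3 * s) =
      I * (p * (1 - p) * s ^ 2 / 2 * (1 - 3 * s)) := by ring
  rw [binMgf_eq_pow, e, Real.exp_nat_mul]
  refine pow_le_pow_left₀ (Real.exp_pos _).le ?_ I
  set v := p * (1 - p) * s ^ 2 with hv
  have hv0 : 0 ≤ v := by positivity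
  have hvs : v ≤ s := by
    have : p * (1 - p) ≤ 1 := by nlinarith
    have : v ≤ 1 * s ^ 2 := mul_le_mul_of_nonneg_right this (sq_nonneg s)
    nlinarith
  have hy : 0 ≤ v * (1 / 2 - s) := mul_nonneg hv0 (by linarith)
  have hyv : v * (1 / 2 - s) ≤ v / 2 := by nlinarith
  refine le_trans (Real.exp_le_exp.mpr ?_) ((exp_sub_sq_le_one_add hy).trans ?_)
  · have : (v * (1 / 2 - s)) ^ 2 ≤ (v / 2) ^ 2 := pow_le_pow_left₀ hy hyv 2
    nlinarith [mul_nonneg hv0 (sub_nonneg.mpr hvs), mul_nonneg hv0 hs]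
  · have : p * (1 - p) * s ^ 3 = v * s := by rw [hv]; ring
    rw [this] at h
    linarith

/-- Chernoff bound in the moderate deviations range. -/
lemma binTail_le (I : ℕ) {p s : ℝ} (h0 : 0 ≤ p) (h1 : p ≤ 1) (hs : 0 ≤ s) (hs1 : s ≤ 1) :
    binTail I p (I * p + s * (I * p * (1 - p))) ≤
      Real.exp (-(I * p * (1 - p) * s ^ 2 / 2 * (1 - 3 * s))) := by
  set V := (I : ℝ) * p * (1 - p) with hV
  have hM : binTail I p (I * p + s * V) ≤ Real.exp (-(s * (s * V))) * binMgf I p s := by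
    unfold binTail binMgf
    rw [Finset.mul_sum]
    refine Finset.sum_le_sum fun j _ => ?_
    rw [mul_left_comm (Real.exp _)]
    refine mul_le_mul_of_nonneg_left ?_ (binPmf_nonneg I h0 h1 j)
    rw [← Real.exp_add]
    split_ifs with h
    · exact Real.one_le_exp (by nlinarith)
    · positivity
  refine hM.trans ?_
  refine (mul_le_mul_of_nonneg_left (binMgf_le I h0 h1 hs hs1) (Real.exp_pos _).le).trans ?_
  rw [← Real.exp_add, ← hV]
  exact Real.exp_le_exp.mpr (le_of_eq (by ring))

/-- Splitting of the moment generating function according to whether the variable falls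
below, inside, or above the window between one and `1 + 2ε` times the deviation `D`. -/
lemma binMgf_le_add (I : ℕ) {p s D ε : ℝ} (h0 : 0 ≤ p) (h1 : p ≤ 1) (hs : 0 ≤ s) (hε : 0 ≤ ε) :
    binMgf I p ((1 + ε) * s) ≤
      Real.exp (s * D * ((1 + ε) * (1 + 2 * ε))) * binTail I p (I * p + D) +
      Real.exp (s * D * ε) * binMgf I p s +
      Real.exp (-(s * D * (ε * (1 + 2 * ε)))) * binMgf I p ((1 + 2 * ε) * s) := by
  unfold binTail binMgf
  simp only [Finset.mul_sum, ← Finset.sum_add_distrib]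
  refine Finset.sum_le_sum fun j _ => ?_
  set Y : ℝ := ((j : ℕ) : ℝ) - I * p with hY
  have hj : (I * p + D ≤ ((j : ℕ) : ℝ)) ↔ D ≤ Y := by
    rw [hY]; constructor <;> intro h <;> linarith
  simp only [hj]
  have key : Real.exp ((1 + ε) * s * Y) ≤
      Real.exp (s * D * ((1 + ε) * (1 + 2 * ε))) * (if D ≤ Y then 1 else 0) +
      Real.exp (s * D * ε) * Real.exp (s * Y) +
      Real.exp (-(s * D * (ε * (1 + 2 * ε)))) * Real.exp ((1 + 2 * ε) * s * Y) := by
    rw [← Real.exp_add, ← Real.exp_add]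
    have p2 := Real.exp_pos (s * D * ε + s * Y)
    have p3 := Real.exp_pos (-(s * D * (ε * (1 + 2 * ε))) + (1 + 2 * ε) * s * Y)
    have hsε : 0 ≤ s * ε := mul_nonneg hs hε
    split_ifs with h
    · have p1 := Real.exp_pos (s * D * ((1 + ε) * (1 + 2 * ε)))
      rcases le_total Y ((1 + 2 * ε) * D) with h' | h'
      · have : Real.exp ((1 + ε) * s * Y) ≤ Real.exp (s * D * ((1 + ε) * (1 + 2 * ε))) :=
          Real.exp_le_exp.mpr (by
            nlinarith [mul_nonneg (mul_nonneg hs (by linarith : 0 ≤ 1 + ε)) (sub_nonneg.mpr h')])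
        linarith
      · have : Real.exp ((1 + ε) * s * Y) ≤
            Real.exp (-(s * D * (ε * (1 + 2 * ε))) + (1 + 2 * ε) * s * Y) :=
          Real.exp_le_exp.mpr (by nlinarith [mul_nonneg hsε (sub_nonneg.mpr h')])
        linarith
    · have : Real.exp ((1 + ε) * s * Y) ≤ Real.exp (s * D * ε + s * Y) :=
        Real.exp_le_exp.mpr (by nlinarith [mul_nonneg hsε (sub_nonneg.mpr (not_le.mp h).le)])
      linarith
  have := mul_le_mul_of_nonneg_left key (binPmf_nonneg I h0 h1 j)
  linarith

/-- Lower bound for the tail in the moderate deviations range. -/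
lemma le_binTail (I : ℕ) {p s ε : ℝ} (h0 : 0 ≤ p) (h1 : p ≤ 1) (hs : 0 ≤ s) (hε : 0 ≤ ε)
    (hε1 : ε ≤ 1) (hsε : 400 * s ≤ ε ^ 2) (hV : 16 ≤ I * p * (1 - p) * s ^ 2 * ε ^ 2) :
    1 / 2 * Real.exp (-(I * p * (1 - p) * s ^ 2 / 2 * (1 + 8 * ε))) ≤
      binTail I p (I * p + s * (I * p * (1 - p))) := by
  have hq : 0 ≤ 1 - p := by linarith
  have hs1 : 400 * s ≤ 1 := by nlinarith
  have main := binMgf_le_add I (D := s * (I * p * (1 - p))) h0 h1 hs hε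
  have m1 := le_binMgf I h0 h1 (s := (1 + ε) * s) (by positivity) (by nlinarith)
  have m2 := binMgf_le I h0 h1 hs (by linarith)
  have m3 := binMgf_le I h0 h1 (s := (1 + 2 * ε) * s) (by positivity) (by nlinarith)
  set t := binTail I p (I * p + s * (I * p * (1 - p))) with ht
  have hsD : s * (s * (I * p * (1 - p))) = I * p * (1 - p) * s ^ 2 := by ring
  rw [hsD] at main
  have e1 : (I : ℝ) * p * (1 - p) * ((1 + ε) * s) ^ 2 =
    I * p * (1 - p) * s ^ 2 * (1 + ε) ^ 2 := by ring
  have e3 : (I : ℝ) * p * (1 - p) * ((1 + 2 * ε) * s) ^ 2 =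
    I * p * (1 - p) * s ^ 2 * (1 + 2 * ε) ^ 2 := by ring
  rw [e1] at m1
  rw [e3] at m3
  set W := (I : ℝ) * p * (1 - p) * s ^ 2 with hW
  have hW0 : 0 ≤ W := by positivity
  have hc : (1 + ε) ^ 3 ≤ 8 := by
    calc (1 + ε) ^ 3 ≤ 2 ^ 3 := by gcongr; linarith
      _ = 8 := by norm_num
  have hd : (1 + 2 * ε) ^ 3 ≤ 27 := by
    calc (1 + 2 * ε) ^ 3 ≤ 3 ^ 3 := by gcongr; linarith
      _ = 27 := by norm_num
  set A := Real.exp (W * (1 / 2 + ε + ε ^ 2 / 8)) with hA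
  have n1 : 4 * A ≤ binMgf I p ((1 + ε) * s) := by
    refine le_trans ?_ m1
    have h4 : (4 : ℝ) ≤ Real.exp 4 := by
      have := Real.add_one_le_exp (4 : ℝ); linarith
    refine (mul_le_mul_of_nonneg_right h4 (Real.exp_pos _).le).trans ?_
    rw [← Real.exp_add]
    refine Real.exp_le_exp.mpr ?_
    have : 1 / 2 + ε + 3 * ε ^ 2 / 8 ≤ (1 + ε) ^ 2 / 2 * (1 - 3 * ((1 + ε) * s)) := by
      have : (1 + ε) ^ 3 * s ≤ 8 * s := by gcongr
      nlinarith
    have := mul_le_mul_of_nonneg_left this hW0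
    nlinarith
  have n2 : Real.exp (W * ε) * binMgf I p s ≤ A := by
    refine (mul_le_mul_of_nonneg_left m2 (Real.exp_pos _).le).trans ?_
    rw [← Real.exp_add]
    refine Real.exp_le_exp.mpr ?_
    have : ε + 1 / 2 * (1 + 3 * s) ≤ 1 / 2 + ε + ε ^ 2 / 8 := by linarith
    have := mul_le_mul_of_nonneg_left this hW0
    linarith
  have n3 : Real.exp (-(W * (ε * (1 + 2 * ε)))) * binMgf I p ((1 + 2 * ε) * s) ≤ A := by
    refine (mul_le_mul_of_nonneg_left m3 (Real.exp_pos _).le).trans ?_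
    rw [← Real.exp_add]
    refine Real.exp_le_exp.mpr ?_
    have : -(ε * (1 + 2 * ε)) + (1 + 2 * ε) ^ 2 / 2 * (1 + 3 * ((1 + 2 * ε) * s)) ≤
        1 / 2 + ε + ε ^ 2 / 8 := by
      have : (1 + 2 * ε) ^ 3 * s ≤ 27 * s := by gcongr
      nlinarith
    have := mul_le_mul_of_nonneg_left this hW0
    linarith
  have hB : 2 * A ≤ Real.exp (W * ((1 + ε) * (1 + 2 * ε))) * t := by linarith
  have hC : Real.exp (-(W / 2 * (1 + 8 * ε))) * Real.exp (W * ((1 + ε) * (1 + 2 * ε))) ≤ A := by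
    rw [← Real.exp_add]
    refine Real.exp_le_exp.mpr ?_
    have : -(1 / 2 * (1 + 8 * ε)) + (1 + ε) * (1 + 2 * ε) ≤ 1 / 2 + ε + ε ^ 2 / 8 := by
      nlinarith
    have := mul_le_mul_of_nonneg_left this hW0
    linarith
  have hA0 : 0 < A := Real.exp_pos _
  have hE := Real.exp_pos (W * ((1 + ε) * (1 + 2 * ε)))
  refine le_of_mul_le_mul_left ?_ hE
  linarith

/-- Lemma 4 (first regime): if `M_n` is the maximum of `Λ_n` i.i.d. `Binomial(I_n,p_n)`
variables, `Λ_n → ∞`, `I_n p_n/(log Λ_n)³ → ∞`, and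
`k_{α,n} = I_n p_n + sqrt(2α I_n p_n (1-p_n) log Λ_n)`, then `ℙ(M_n ≥ k_{α,n}) → 0`
when `α > 1` and `ℙ(M_n ≥ k_{α,n}) → 1` when `0 < α < 1`. -/
theorem lemma4_first_regime (Λ I : ℕ → ℕ) (p : ℕ → ℝ) (α : ℝ) (hα : 0 < α)
    (hΛ : Filter.Tendsto Λ Filter.atTop Filter.atTop)
    (hI : ∀ n, 1 ≤ I n)
    (hp : ∀ n, 0 < p n ∧ p n ≤ 1 / 2)
    (hreg : Filter.Tendsto (fun n => (I n : ℝ) * p n / (Real.log (Λ n)) ^ 3)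
      Filter.atTop Filter.atTop) :
    (1 < α →
      Filter.Tendsto
        (fun n => probMaxGe (I n) (Λ n) (p n)
          ((I n : ℝ) * p n +
            Real.sqrt (2 * α * (I n : ℝ) * p n * (1 - p n) * Real.log (Λ n))))
        Filter.atTop (nhds 0)) ∧
    (α < 1 →
      Filter.Tendsto
        (fun n => probMaxGe (I n) (Λ n) (p n)
          ((I n : ℝ) * p n +
            Real.sqrt (2 * α * (I n : ℝ) * p n * (1 - p n) * Real.log (Λ n))))
        Filter.atTop (nhds 1)) := by
  have hL : Filter.Tendsto (fun n => Real.log (Λ n)) Filter.atTop Filter.atTop :=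
    Real.tendsto_log_atTop.comp (tendsto_natCast_atTop_atTop.comp hΛ)
  -- the saddle point
  set s : ℕ → ℝ := fun n =>
    Real.sqrt (2 * α * Real.log (Λ n) / ((I n : ℝ) * p n * (1 - p n))) with hs_def
  have hV : ∀ n, 0 < (I n : ℝ) * p n * (1 - p n) := fun n => by
    have h1 : (0 : ℝ) < I n := by exact_mod_cast hI n
    have h2 := hp n
    have h3 : 0 < 1 - p n := by linarith
    have h4 := h2.1
    positivity
  have hlog : ∀ n, 0 ≤ Real.log (Λ n) := fun n => Real.log_natCast_nonneg _
  have hs2 : ∀ n, (I n : ℝ) * p n * (1 - p n) * s n ^ 2 = 2 * α * Real.log (Λ n) := fun n => by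
    have := hV n
    have h := hlog n
    rw [hs_def]
    simp only
    rw [Real.sq_sqrt (by positivity), mul_div_cancel₀ _ this.ne']
  have hs0 : ∀ n, 0 ≤ s n := fun n => Real.sqrt_nonneg _
  have hsV : ∀ n, Real.sqrt (2 * α * (I n : ℝ) * p n * (1 - p n) * Real.log (Λ n)) =
      s n * ((I n : ℝ) * p n * (1 - p n)) := fun n => by
    rw [Real.sqrt_eq_iff_mul_self_eq (by
      have := hV n
      have h := hlog n
      have e : 2 * α * (I n : ℝ) * p n * (1 - p n) * Real.log (Λ n) =
        2 * α * ((I n : ℝ) * p n * (1 - p n)) * Real.log (Λ n) := by ring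
      rw [e]; positivity) (mul_nonneg (hs0 n) (hV n).le)]
    linear_combination -((I n : ℝ) * p n * (1 - p n)) * hs2 n
  have hsmall : ∀ δ : ℝ, 0 < δ → ∀ᶠ n in Filter.atTop, s n ≤ δ := fun δ hδ => by
    filter_upwards [hreg.eventually_ge_atTop (4 * α / δ ^ 2), hL.eventually_ge_atTop 1] with n h1 h2
    refine Real.sqrt_le_iff.mpr ⟨hδ.le, ?_⟩
    rw [div_le_iff₀ (hV n)]
    rw [le_div_iff₀ (by positivity), div_mul_eq_mul_div, div_le_iff₀ (by positivity)] at h1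
    have h3 : Real.log (Λ n) ≤ Real.log (Λ n) ^ 3 := le_self_pow₀ h2 (by norm_num)
    have h4 : 4 * α * Real.log (Λ n) ≤ 4 * α * Real.log (Λ n) ^ 3 := by gcongr
    have h5 : (I n : ℝ) * p n * δ ^ 2 * (1 / 2) ≤ (I n : ℝ) * p n * δ ^ 2 * (1 - p n) := by
      have := hp n
      have h6 := this.1
      gcongr
      linarith
    linarith
  have hprob : ∀ n, probMaxGe (I n) (Λ n) (p n) ((I n : ℝ) * p n +
      Real.sqrt (2 * α * (I n : ℝ) * p n * (1 - p n) * Real.log (Λ n))) =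
      1 - (1 - binTail (I n) (p n) ((I n : ℝ) * p n +
        s n * ((I n : ℝ) * p n * (1 - p n)))) ^ Λ n := fun n => by
    have h1 : (0 : ℝ) < I n := by exact_mod_cast hI n
    have h2 := (hp n).1
    rw [probMaxGe_eq, hsV]
    positivity
  simp only [hprob]
  set t : ℕ → ℝ := fun n => binTail (I n) (p n) ((I n : ℝ) * p n +
        s n * ((I n : ℝ) * p n * (1 - p n))) with ht
  have hp1 : ∀ n, p n ≤ 1 := fun n => by linarith [(hp n).2]
  have ht0 : ∀ n, 0 ≤ t n := fun n => binTail_nonneg _ (hp n).1.le (hp1 n) _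
  have ht1 : ∀ n, t n ≤ 1 := fun n => binTail_le_one _ (hp n).1.le (hp1 n) _
  have hexp : ∀ᶠ n in Filter.atTop, (Λ n : ℝ) = Real.exp (Real.log (Λ n)) := by
    filter_upwards [hΛ.eventually_ge_atTop 1] with n hn
    rw [Real.exp_log (by exact_mod_cast hn)]
  constructor
  · intro hα1
    have hlim : Filter.Tendsto (fun n => Real.exp (-((α - 1) / 2 * Real.log (Λ n))))
        Filter.atTop (nhds 0) :=
      Real.tendsto_exp_neg_atTop_nhds_zero.comp (hL.const_mul_atTop (by linarith))
    refine squeeze_zero' (Filter.Eventually.of_forall fun n => ?_) ?_ hlim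
    · exact sub_nonneg.mpr (pow_le_one₀ (by linarith [ht1 n]) (by linarith [ht0 n]))
    · filter_upwards [hexp, hsmall 1 one_pos,
        hsmall ((α - 1) / (6 * α)) (div_pos (by linarith) (by linarith))] with n h1 h2 h3
      have hb := one_add_mul_le_pow (a := -t n) (by linarith [ht1 n]) (Λ n)
      have hb' : 1 - (1 - t n) ^ Λ n ≤ Λ n * t n := by
        rw [← sub_eq_add_neg] at hb; linarith
      refine hb'.trans ?_
      have hu := binTail_le (I n) (hp n).1.le (hp1 n) (hs0 n) h2
      rw [hs2] at hu
      refine (mul_le_mul_of_nonneg_left hu (Nat.cast_nonneg _)).trans ?_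
      rw [h1, ← Real.exp_add, Real.log_exp]
      refine Real.exp_le_exp.mpr ?_
      rw [le_div_iff₀ (by linarith)] at h3
      nlinarith [mul_le_mul_of_nonneg_left h3 (hlog n)]
  · intro hα1
    set ε := (1 - α) / 16 with hε
    have hε0 : 0 < ε := by rw [hε]; linarith
    have hlim : Filter.Tendsto
        (fun n => 1 - Real.exp (-(1 / 2 * Real.exp ((1 - α) / 2 * Real.log (Λ n)))))
        Filter.atTop (nhds 1) := by
      have h1 := Real.tendsto_exp_neg_atTop_nhds_zero.comp ((Real.tendsto_exp_atTop.comp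
        (hL.const_mul_atTop (by linarith : 0 < (1 - α) / 2))).const_mul_atTop
          (by norm_num : (0 : ℝ) < 1 / 2))
      simpa using h1.const_sub 1
    refine tendsto_of_tendsto_of_tendsto_of_le_of_le' hlim tendsto_const_nhds ?_
      (Filter.Eventually.of_forall fun n => ?_)
    · filter_upwards [hexp, hsmall (ε ^ 2 / 400) (by positivity),
        hL.eventually_ge_atTop (16 / (2 * α * ε ^ 2))] with n h1 h2 h3
      rw [div_le_iff₀ (by positivity)] at h3
      have hl := le_binTail (I n) (hp n).1.le (hp1 n) (hs0 n) hε0.le (by rw [hε]; linarith)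
        (by linarith) (by rw [hs2]; linarith)
      rw [hs2] at hl
      have hpow : (1 - t n) ^ Λ n ≤ Real.exp (-(Λ n * t n)) := by
        have : 1 - t n ≤ Real.exp (-t n) := by linarith [Real.add_one_le_exp (-t n)]
        refine (pow_le_pow_left₀ (by linarith [ht1 n]) this _).trans (le_of_eq ?_)
        rw [← Real.exp_nat_mul]
        ring_nf
      have hNt : 1 / 2 * Real.exp ((1 - α) / 2 * Real.log (Λ n)) ≤ Λ n * t n := by
        refine le_trans ?_ (mul_le_mul_of_nonneg_left hl (Nat.cast_nonneg _))
        rw [mul_left_comm]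
        refine mul_le_mul_of_nonneg_left ?_ (by norm_num)
        nth_rewrite 2 [h1]
        rw [← Real.exp_add]
        refine Real.exp_le_exp.mpr ?_
        have : (1 - α) / 2 ≤ 1 - α * (1 + 8 * ε) := by rw [hε]; nlinarith
        have := mul_le_mul_of_nonneg_right this (hlog n)
        linarith
      have : Real.exp (-(Λ n * t n)) ≤
          Real.exp (-(1 / 2 * Real.exp ((1 - α) / 2 * Real.log (Λ n)))) :=
        Real.exp_le_exp.mpr (neg_le_neg hNt)
      change 1 - _ ≤ 1 - (1 - t n) ^ Λ n
      linarith
    · have : 0 ≤ (1 - t n) ^ Λ n := pow_nonneg (by linarith [ht1 n]) _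
      change 1 - (1 - t n) ^ Λ n ≤ 1
      linarith

end
end

section
/- Balanced profiles minimize the delay functional. Let Λ ≥ 1 and t be integers with 1 ≤ t ≤ Λ−1, let d ≥ 0 be an integer, and set q = ⌊d/Λ⌋ and A = d − Λq. For every vector v ∈ ℕ^Λ with Σ_{λ=1}^{Λ} v_λ = d, letting l_1 ≥ … ≥ l_Λ be the decreasing rearrangement of v, Σ_{λ=1}^{Λ−t} l_λ · C(Λ−λ,t)/C(Λ,t) ≥ (q+1)·(Λ−t)/(1+t) − C(Λ−A, t+1)/C(Λ,t), where C(n,k) = 0 when k > n. Moreover, equality holds for the balanced vector having A entries equal to q+1 and Λ−A entries equal to q. -/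
open Finset

noncomputable section

/-- Delay functional of a load vector `v`:
`∑_{λ=1}^{Λ-t} l_λ C(Λ-λ,t)/C(Λ,t)` where `l` is the decreasing rearrangement of `v`
(with the convention `C(n,k) = 0` for `k > n`). -/
def delayFn {Λ : ℕ} (v : Fin Λ → ℕ) (t : ℕ) : ℝ :=
  ∑ i ∈ Finset.range (Λ - t),
    (sortDescN v i : ℝ) * ((Λ - 1 - i).choose t : ℝ) / (Λ.choose t : ℝ)

theorem sortDescN_antitone {Λ : ℕ} (v : Fin Λ → ℕ) : Antitone (sortDescN v) := by
  intro i j hij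
  unfold sortDescN
  by_cases hj : j < Λ
  · rw [dif_pos hj, dif_pos (hij.trans_lt hj)]
    exact Tuple.monotone_sort v (Fin.rev_le_rev.mpr hij)
  · rw [dif_neg hj]
    exact Nat.zero_le _

theorem sum_range_sortDescN {Λ : ℕ} (v : Fin Λ → ℕ) :
    ∑ i ∈ Finset.range Λ, sortDescN v i = ∑ c, v c := by
  rw [Finset.sum_range]
  simp only [sortDescN, Fin.is_lt, dif_pos, Fin.eta]
  rw [← Equiv.sum_comp (Tuple.sort v) v]
  exact Equiv.sum_comp Fin.revPerm (v ∘ Tuple.sort v)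

theorem sortDescN_of_antitone {Λ : ℕ} {v : Fin Λ → ℕ} (hv : Antitone v) {i : ℕ} (hi : i < Λ) :
    sortDescN v i = v ⟨i, hi⟩ := by
  have h : v ∘ Tuple.sort v = v ∘ Fin.revPerm :=
    Tuple.unique_monotone (Tuple.monotone_sort v)
      fun _ _ hab => hv (Fin.rev_le_rev.mpr hab)
  rw [sortDescN, dif_pos hi, h]
  simp

/-- Hockey-stick identity for the largest `m` of the weights `C(n-1-i,t)`. -/
theorem sum_range_choose_sub {n m : ℕ} (t : ℕ) (h : m ≤ n) :
    ∑ i ∈ Finset.range m, ((n - 1 - i).choose t : ℝ) =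
      (n.choose (t + 1) : ℝ) - ((n - m).choose (t + 1) : ℝ) := by
  induction m with
  | zero => simp
  | succ m ih =>
    rw [Finset.sum_range_succ, ih (by omega)]
    obtain ⟨k, rfl⟩ : ∃ k, n = k + m + 1 := ⟨n - m - 1, by omega⟩
    rw [show k + m + 1 - m = k + 1 by omega, show k + m + 1 - 1 - m = k by omega,
      show k + m + 1 - (m + 1) = k by omega, Nat.choose_succ_succ k t]
    push_cast
    ring

theorem delayFn_eq_sum_range {Λ : ℕ} (v : Fin Λ → ℕ) (t : ℕ) :
    delayFn v t =
      (∑ i ∈ Finset.range Λ, (sortDescN v i : ℝ) * ((Λ - 1 - i).choose t : ℝ)) /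
        (Λ.choose t : ℝ) := by
  rw [delayFn, Finset.sum_div]
  refine Finset.sum_subset (Finset.range_mono (Nat.sub_le _ _)) fun i hi hi' => ?_
  simp only [Finset.mem_range] at hi hi'
  rw [Nat.choose_eq_zero_of_lt (show Λ - 1 - i < t by omega)]
  simp

/-- Among antitone sequences of fixed sum, one taking only the values `q` and `q + 1`
minimizes every pairing with an antitone weight. -/
theorem sum_mul_le_sum_mul_of_balanced {n q : ℕ} {b l : ℕ → ℕ} {w : ℕ → ℝ}
    (hl : Antitone l) (hw : Antitone w) (hl0 : ∃ i, l i ≤ q)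
    (hb : ∀ i, q ≤ b i ∧ b i ≤ q + 1)
    (hsum : ∑ i ∈ Finset.range n, b i = ∑ i ∈ Finset.range n, l i) :
    ∑ i ∈ Finset.range n, (b i : ℝ) * w i ≤ ∑ i ∈ Finset.range n, (l i : ℝ) * w i := by
  obtain ⟨k, hk, hmin⟩ : ∃ k, l k ≤ q ∧ ∀ i < k, q < l i :=
    ⟨Nat.find hl0, Nat.find_spec hl0, fun i hi => not_le.mp (Nat.find_min hl0 hi)⟩
  have hnonneg : 0 ≤ ∑ i ∈ Finset.range n, ((l i : ℝ) - b i) * (w i - w k) := by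
    refine Finset.sum_nonneg fun i _ => ?_
    rcases lt_or_ge i k with hik | hik
    · have h : b i ≤ l i := (hb i).2.trans (hmin i hik)
      exact mul_nonneg (sub_nonneg.mpr (by exact_mod_cast h)) (sub_nonneg.mpr (hw hik.le))
    · have h : l i ≤ b i := ((hl hik).trans hk).trans (hb i).1
      exact mul_nonneg_of_nonpos_of_nonpos
        (sub_nonpos.mpr (by exact_mod_cast h)) (sub_nonpos.mpr (hw hik))
  have hsum' : ∑ i ∈ Finset.range n, (b i : ℝ) = ∑ i ∈ Finset.range n, (l i : ℝ) := by
    exact_mod_cast hsum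
  simp only [sub_mul, mul_sub, Finset.sum_sub_distrib, ← Finset.sum_mul, hsum'] at hnonneg
  linarith

theorem sum_range_balanced_mul {n A : ℕ} (hA : A ≤ n) (q : ℕ) (w : ℕ → ℝ) :
    ∑ i ∈ Finset.range n, ((if i < A then q + 1 else q : ℕ) : ℝ) * w i =
      q * ∑ i ∈ Finset.range n, w i + ∑ i ∈ Finset.range A, w i := by
  have h : ∀ i, ((if i < A then q + 1 else q : ℕ) : ℝ) * w i =
      q * w i + if i < A then w i else 0 := by
    intro i
    split_ifs <;> push_cast <;> ring
  simp only [h, Finset.sum_add_distrib, ← Finset.mul_sum, ← Finset.sum_filter]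
  congr 2
  ext i
  simp only [Finset.mem_filter, Finset.mem_range]
  omega

/-- Balanced profiles minimize the delay functional: with `q = ⌊d/Λ⌋` and
`A = d - Λq`, every `v ∈ ℕ^Λ` summing to `d` has delay at least
`(q+1)(Λ-t)/(1+t) - C(Λ-A,t+1)/C(Λ,t)`, with equality for the balanced vector
having `A` entries equal to `q+1` and `Λ-A` entries equal to `q`. -/
theorem balanced_minimizes_delay (Λ t d : ℕ) (hΛ : 1 ≤ Λ) (ht1 : 1 ≤ t) (ht2 : t ≤ Λ - 1) :
    (∀ v : Fin Λ → ℕ, (∑ c, v c) = d →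
      (((d / Λ : ℕ) : ℝ) + 1) * (((Λ : ℝ) - t) / (1 + t)) -
          (((Λ - (d - Λ * (d / Λ))).choose (t + 1) : ℝ) / (Λ.choose t : ℝ)) ≤
        delayFn v t) ∧
    delayFn (fun i : Fin Λ => if (i : ℕ) < d - Λ * (d / Λ) then d / Λ + 1 else d / Λ) t =
      (((d / Λ : ℕ) : ℝ) + 1) * (((Λ : ℝ) - t) / (1 + t)) -
        (((Λ - (d - Λ * (d / Λ))).choose (t + 1) : ℝ) / (Λ.choose t : ℝ)) := by
  set q := d / Λ
  set A := d - Λ * q with hA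
  have hdA : d = Λ * q + A := by
    have : Λ * q ≤ d := Nat.mul_div_le d Λ
    omega
  have hAΛ : A ≤ Λ := by
    have : Λ * q + d % Λ = d := Nat.div_add_mod d Λ
    have := Nat.mod_lt d hΛ
    omega
  have htΛ : t ≤ Λ := by omega
  have hpos : (0 : ℝ) < Λ.choose t := by exact_mod_cast Nat.choose_pos htΛ
  have hratio : (Λ.choose (t + 1) : ℝ) * (t + 1) = Λ.choose t * ((Λ : ℝ) - t) := by
    have := Nat.choose_succ_right_eq Λ t
    rw [← Nat.cast_sub htΛ]
    exact_mod_cast this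
  have hval : ((q : ℝ) + 1) * (((Λ : ℝ) - t) / (1 + t)) -
      ((Λ - A).choose (t + 1) : ℝ) / (Λ.choose t : ℝ) =
      (∑ i ∈ Finset.range Λ,
        ((if i < A then q + 1 else q : ℕ) : ℝ) * ((Λ - 1 - i).choose t : ℝ)) /
          (Λ.choose t : ℝ) := by
    rw [sum_range_balanced_mul hAΛ, sum_range_choose_sub t le_rfl, sum_range_choose_sub t hAΛ,
      Nat.sub_self, Nat.choose_zero_succ]
    have ht : (0 : ℝ) < 1 + t := by positivity
    have hdiv : ((Λ : ℝ) - t) / (1 + t) = Λ.choose (t + 1) / Λ.choose t := by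
      rw [div_eq_div_iff ht.ne' hpos.ne']
      linarith
    rw [hdiv]
    push_cast
    ring
  rw [hval]
  refine ⟨fun v hv => ?_, ?_⟩
  · rw [delayFn_eq_sum_range]
    refine div_le_div_of_nonneg_right ?_ hpos.le
    refine sum_mul_le_sum_mul_of_balanced (q := q) (b := fun i => if i < A then q + 1 else q)
      (w := fun i => ((Λ - 1 - i).choose t : ℝ)) (sortDescN_antitone v) ?_ ⟨Λ, ?_⟩ ?_ ?_
    · intro i j hij
      exact Nat.cast_le.mpr (Nat.choose_le_choose t (by omega))
    · simp [sortDescN]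
    · intro i
      split_ifs <;> omega
    · have h := sum_range_balanced_mul hAΛ q fun _ => 1
      simp only [mul_one, Finset.sum_const, Finset.card_range, nsmul_eq_mul] at h
      rw [sum_range_sortDescN, hv, hdA, mul_comm]
      exact_mod_cast h
  · rw [delayFn_eq_sum_range]
    congr 1
    refine Finset.sum_congr rfl fun i hi => ?_
    rw [sortDescN_of_antitone _ (Finset.mem_range.mp hi)]
    intro a b hab
    have hab' : (a : ℕ) ≤ b := hab
    dsimp only
    split_ifs <;> omega

end
end
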